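/- Suppose n ≥ 2 and let τ ⊂ 𝕋 be r points with (n+1)Δ(τ) ≥ α for some α > 0. Then the 2r×2r matrix D(τ), with blocks [D₀]_{ij} = F_N(τ_i − τ_j), [D₁]_{ij} = −F_N'(τ_i − τ_j)/√(−F_N''(0)), [D₂]_{ij} = F_N''(τ_i − τ_j)/F_N''(0), satisfies ‖D(τ) − I‖_∞ ≤ K_Δ ((n+1)Δ(τ))^{-2}, where K_Δ = max{C₀ + (3√3/(4π))C₁, (3√3/(4π))C₁ + (27/(16π²))C₂} and C₀, C₁, C₂ are the constants of the Fejér summation lemma with parameters α and β = 0. -/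

import Mathlib

open Real Matrix

/-- The normalized Fejér kernel of order `N = 2n+1`:
`F_N(t) = (1/(n+1)) ∑_{k=-n}^{n} (1 - |k|/(n+1)) e^{i2πkt}`, written in its real (cosine) form. -/
noncomputable def fejer (n : ℕ) (t : ℝ) : ℝ :=
  (1 / (n + 1)) * ∑ k ∈ Finset.Icc (-(n : ℤ)) n, (1 - |(k : ℝ)| / (n + 1)) * Real.cos (2 * π * k * t)

/-- The minimal wrap-around distance `Δ(τ) = min_{ℓ≠ℓ'} inf_{p∈ℤ} |τ_ℓ − τ_{ℓ'} + p|`. -/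
noncomputable def sep {r : ℕ} (τ : Fin r → ℝ) : ℝ :=
  sInf {d : ℝ | ∃ (i j : Fin r) (p : ℤ), i ≠ j ∧ d = |τ i - τ j + p|}

/-- The induced infinity (maximum absolute row-sum) operator norm of a real matrix. -/
noncomputable def opInf {m : Type*} [Fintype m] (A : Matrix m m ℝ) : ℝ := ⨆ i, ∑ j, |A i j|

/-- The `2r × 2r` matrix `D(τ)` with blocks built from the Fejér kernel and its derivatives. -/
noncomputable def Dmat (n r : ℕ) (τ : Fin r → ℝ) : Matrix (Fin r ⊕ Fin r) (Fin r ⊕ Fin r) ℝ :=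
  Matrix.fromBlocks
    (Matrix.of fun i j => fejer n (τ i - τ j))
    (Matrix.of fun i j => -(deriv (fejer n) (τ i - τ j)) /
      Real.sqrt (-(iteratedDeriv 2 (fejer n) 0)))
    (Matrix.of fun i j => -(deriv (fejer n) (τ i - τ j)) /
      Real.sqrt (-(iteratedDeriv 2 (fejer n) 0)))ᵀ
    (Matrix.of fun i j => iteratedDeriv 2 (fejer n) (τ i - τ j) / iteratedDeriv 2 (fejer n) 0)

/-- Points that are `δ`-separated from each other and from `0` have controlled inverse power sums. -/
theorem sum_one_div_pow_le_of_pos {ι : Type*} (s : Finset ι) (x : ι → ℝ) {δ : ℝ} (hδ : 0 < δ)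
    (hx : ∀ a ∈ s, δ ≤ x a) (hsep : ∀ a ∈ s, ∀ b ∈ s, a ≠ b → δ ≤ |x a - x b|) {e : ℕ} {Z : ℝ}
    (hZ : HasSum (fun n : ℕ => 1 / (n : ℝ) ^ e) Z) :
    ∑ a ∈ s, 1 / x a ^ e ≤ Z / δ ^ e := by
  have hinj : Set.InjOn (fun a => ⌊x a / δ⌋₊) s := by
    intro a ha b hb hab
    by_contra hne
    have h := hsep a ha b hb hne
    have hab' : (⌊x a / δ⌋₊ : ℝ) = ⌊x b / δ⌋₊ := by exact_mod_cast hab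
    have h1 : |x a / δ - x b / δ| < 1 := by
      have ha₁ := Nat.floor_le (div_nonneg (hδ.le.trans (hx a ha)) hδ.le)
      have hb₁ := Nat.floor_le (div_nonneg (hδ.le.trans (hx b hb)) hδ.le)
      have ha₂ := Nat.lt_floor_add_one (x a / δ)
      have hb₂ := Nat.lt_floor_add_one (x b / δ)
      rw [abs_lt]
      constructor <;> linarith
    rw [← sub_div, abs_div, abs_of_pos hδ, div_lt_one hδ] at h1
    linarith
  have hterm : ∀ a ∈ s, 1 / x a ^ e ≤ 1 / δ ^ e * (1 / (⌊x a / δ⌋₊ : ℝ) ^ e) := by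
    intro a ha
    have hpos : 0 < ⌊x a / δ⌋₊ := Nat.floor_pos.2 ((one_le_div hδ).2 (hx a ha))
    have hfl : (⌊x a / δ⌋₊ : ℝ) * δ ≤ x a :=
      (le_div_iff₀ hδ).1 (Nat.floor_le (div_nonneg (hδ.le.trans (hx a ha)) hδ.le))
    have hpos' : (0 : ℝ) < ⌊x a / δ⌋₊ := by exact_mod_cast hpos
    rw [one_div_mul_one_div, ← mul_pow, mul_comm δ]
    gcongr
  calc ∑ a ∈ s, 1 / x a ^ e ≤ ∑ a ∈ s, 1 / δ ^ e * (1 / (⌊x a / δ⌋₊ : ℝ) ^ e) :=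
        Finset.sum_le_sum hterm
    _ = 1 / δ ^ e * ∑ n ∈ s.image (fun a => ⌊x a / δ⌋₊), 1 / (n : ℝ) ^ e := by
        rw [Finset.sum_image hinj, Finset.mul_sum]
    _ ≤ 1 / δ ^ e * Z := by
        gcongr
        exact sum_le_hasSum _ (fun n _ => by positivity) hZ
    _ = Z / δ ^ e := by ring

theorem sum_one_div_pow_le {ι : Type*} (s : Finset ι) (x : ι → ℝ) {δ : ℝ} (hδ : 0 < δ)
    (hx : ∀ a ∈ s, δ ≤ |x a|) (hsep : ∀ a ∈ s, ∀ b ∈ s, a ≠ b → δ ≤ |x a - x b|) {e : ℕ}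
    (he : Even e) {Z : ℝ} (hZ : HasSum (fun n : ℕ => 1 / (n : ℝ) ^ e) Z) :
    ∑ a ∈ s, 1 / x a ^ e ≤ 2 * Z / δ ^ e := by
  rw [← Finset.sum_filter_add_sum_filter_not s (fun a => 0 ≤ x a)]
  have hpos := sum_one_div_pow_le_of_pos (s.filter fun a => 0 ≤ x a) x hδ
    (fun a ha => by
      rw [Finset.mem_filter] at ha
      simpa [abs_of_nonneg ha.2] using hx a ha.1)
    (fun a ha b hb => hsep a (Finset.mem_filter.1 ha).1 b (Finset.mem_filter.1 hb).1) hZ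
  have hneg := sum_one_div_pow_le_of_pos (s.filter fun a => ¬ 0 ≤ x a) (fun a => -x a) hδ
    (fun a ha => by
      rw [Finset.mem_filter, not_le] at ha
      simpa [abs_of_neg ha.2] using hx a ha.1)
    (fun a ha b hb hab => by
      rw [neg_sub_neg, abs_sub_comm]
      exact hsep a (Finset.mem_filter.1 ha).1 b (Finset.mem_filter.1 hb).1 hab) hZ
  simp only [he.neg_pow] at hneg
  calc _ ≤ _ := add_le_add hpos hneg
    _ = _ := by ring

/-- Iterating the functional equation `c * f t = f (t / 2) + f ((t + 1) / 2)`. -/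
theorem pow_mul_eq_sum_of_doubling {f : ℝ → ℝ} {c : ℝ}
    (hf : ∀ t : ℝ, (∀ z : ℤ, t ≠ z) → c * f t = f (t / 2) + f ((t + 1) / 2))
    {t : ℝ} (ht : ∀ z : ℤ, t ≠ z) (m : ℕ) :
    c ^ m * f t = ∑ k ∈ Finset.range (2 ^ m), f ((t + k) / 2 ^ m) := by
  induction m with
  | zero => simp
  | succ m ih =>
    rw [pow_succ', mul_assoc, ih, Finset.mul_sum, pow_succ 2 m, mul_two, Finset.sum_range_add,
      ← Finset.sum_add_distrib]
    refine Finset.sum_congr rfl fun k _ => ?_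
    rw [hf]
    · have h1 : (t + k) / 2 ^ m / 2 = (t + k) / (2 ^ m * 2) := div_div _ _ _
      have h2 : ((t + k) / 2 ^ m + 1) / 2 = (t + (2 ^ m + k : ℕ)) / (2 ^ m * 2) := by
        push_cast
        field_simp
        ring
      rw [h1, h2, pow_succ]
    · intro z hz
      rw [div_eq_iff (by positivity)] at hz
      apply ht (z * 2 ^ m - k)
      push_cast
      linarith

theorem le_sum_of_doubling {f g : ℝ → ℝ} {a : ℝ} {e : ℕ} (he : Even e)
    (hf : ∀ t : ℝ, (∀ z : ℤ, t ≠ z) → 2 ^ e * f t = f (t / 2) + f ((t + 1) / 2))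
    (hfg : ∀ y : ℝ, 0 < y → y < 1 → f y ≤ g y + a * (1 / y ^ e + 1 / (1 - y) ^ e))
    {t : ℝ} (ht₀ : 0 < t) (ht₁ : t < 1) (m : ℕ) :
    f t ≤ (∑ k ∈ Finset.range (2 ^ m), g ((t + k) / 2 ^ m)) / (2 ^ e) ^ m +
      a * ∑ k ∈ Finset.range (2 ^ m + 2 ^ m), 1 / (t + ((k : ℤ) - 2 ^ m : ℤ)) ^ e := by
  have ht : ∀ z : ℤ, t ≠ z := by
    rintro z rfl
    have h₀ : 0 < z := by exact_mod_cast ht₀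
    have h₁ : z < 1 := by exact_mod_cast ht₁
    omega
  have key := pow_mul_eq_sum_of_doubling hf ht m
  have hle : ∑ k ∈ Finset.range (2 ^ m), f ((t + k) / 2 ^ m) ≤
      ∑ k ∈ Finset.range (2 ^ m), (g ((t + k) / 2 ^ m) +
        (2 ^ e) ^ m * (a * (1 / (t + k) ^ e + 1 / (t + (k - 2 ^ m)) ^ e))) := by
    refine Finset.sum_le_sum fun k hk => ?_
    have hk' : (k : ℝ) + 1 ≤ 2 ^ m := by exact_mod_cast Finset.mem_range.1 hk
    have hy₀ : 0 < (t + k) / 2 ^ m := by positivity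
    have hy₁ : (t + k) / 2 ^ m < 1 := by
      rw [div_lt_one (by positivity)]
      linarith
    refine (hfg _ hy₀ hy₁).trans_eq ?_
    have h1 : (1 - (t + k) / 2 ^ m) ^ e = (t + (k - 2 ^ m)) ^ e / (2 ^ e) ^ m := by
      rw [← pow_mul, mul_comm e m, pow_mul, ← div_pow, ← he.neg_pow]
      congr 1
      field_simp
      ring
    rw [h1, div_pow, ← pow_mul 2 m e, mul_comm m e, pow_mul]
    simp only [one_div_div]
    ring
  rw [Finset.sum_range_add, ← key] at *
  have hc : (0 : ℝ) < (2 ^ e) ^ m := by positivity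
  rw [← mul_le_mul_iff_right₀ hc, mul_add, mul_div_cancel₀ _ hc.ne']
  refine hle.trans_eq ?_
  rw [Finset.sum_add_distrib, ← Finset.mul_sum, ← Finset.mul_sum, Finset.sum_add_distrib,
    add_comm (∑ k ∈ Finset.range (2 ^ m), 1 / (t + (k:ℝ)) ^ e)]
  push_cast
  simp

/-- The function `t ↦ 1 / sin² (π t)`. -/
noncomputable def cscSq (t : ℝ) : ℝ := (sin (π * t) ^ 2)⁻¹

theorem sin_pi_mul_ne_zero_of_ne_int {t : ℝ} (ht : ∀ z : ℤ, t ≠ z) : sin (π * t) ≠ 0 := by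
  rw [Ne, Real.sin_eq_zero_iff]
  rintro ⟨z, hz⟩
  rw [mul_comm] at hz
  exact ht z (mul_left_cancel₀ pi_ne_zero hz).symm

theorem cscSq_nonneg (t : ℝ) : 0 ≤ cscSq t := by
  unfold cscSq
  positivity

theorem cscSq_one_sub (t : ℝ) : cscSq (1 - t) = cscSq t := by
  rw [cscSq, cscSq, mul_one_sub, Real.sin_pi_sub]

theorem cscSq_periodic : Function.Periodic cscSq 1 := by
  intro t
  rw [cscSq, cscSq, mul_add, mul_one, Real.sin_add_pi, neg_sq]

theorem one_le_cscSq {t : ℝ} (ht : ∀ z : ℤ, t ≠ z) : 1 ≤ cscSq t :=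
  (one_le_inv₀ (sq_pos_of_ne_zero (sin_pi_mul_ne_zero_of_ne_int ht))).2 (Real.sin_sq_le_one _)

theorem cscSq_doubling {t : ℝ} (ht : ∀ z : ℤ, t ≠ z) :
    4 * cscSq t = cscSq (t / 2) + cscSq ((t + 1) / 2) ∧
      cscSq (t / 2) + cscSq ((t + 1) / 2) = cscSq (t / 2) * cscSq ((t + 1) / 2) := by
  have h := sin_pi_mul_ne_zero_of_ne_int ht
  have h2 : sin (π * t) = 2 * sin (π * (t / 2)) * cos (π * (t / 2)) := by
    rw [← Real.sin_two_mul]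
    ring_nf
  have h3 : sin (π * ((t + 1) / 2)) = cos (π * (t / 2)) := by
    rw [← Real.sin_add_pi_div_two]
    ring_nf
  have hs : sin (π * (t / 2)) ≠ 0 := fun h0 => h (by rw [h2, h0]; ring)
  have hc : cos (π * (t / 2)) ≠ 0 := fun h0 => h (by rw [h2, h0]; ring)
  have h1 := Real.sin_sq_add_cos_sq (π * (t / 2))
  have hsum : cscSq (t / 2) + cscSq ((t + 1) / 2) = cscSq (t / 2) * cscSq ((t + 1) / 2) := by
    rw [cscSq, cscSq, h3, inv_add_inv (pow_ne_zero 2 hs) (pow_ne_zero 2 hc), h1, ← mul_inv, one_div]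
  refine ⟨?_, hsum⟩
  rw [hsum, cscSq, cscSq, cscSq, h3, h2]
  field_simp
  norm_num

theorem inv_sq_le_cscSq {t : ℝ} (ht : 0 < t) (ht' : t < 1) : 1 / (π * t) ^ 2 ≤ cscSq t := by
  have hs : 0 < sin (π * t) := Real.sin_pos_of_pos_of_lt_pi (by positivity)
    (by nlinarith [Real.pi_pos])
  have := Real.sin_lt (x := π * t) (by positivity)
  rw [cscSq, ← one_div]
  gcongr

theorem cscSq_le_of_le_half {t : ℝ} (ht : 0 < t) (ht' : t ≤ 1 / 2) :
    cscSq t ≤ 1 + 1 / (π * t) ^ 2 := by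
  have hx : 0 < π * t := by positivity
  have hx' : π * t ≤ π / 2 := by nlinarith [Real.pi_pos]
  have hs : 0 < sin (π * t) := Real.sin_pos_of_pos_of_lt_pi hx (by linarith [Real.pi_pos])
  have hcos : π * t * cos (π * t) ≤ sin (π * t) := by
    rcases hx'.eq_or_lt with h | h
    · rw [h, Real.cos_pi_div_two]
      simp
    · have hc : 0 < cos (π * t) := Real.cos_pos_of_mem_Ioo ⟨by linarith [Real.pi_pos], h⟩
      have := Real.lt_tan hx h
      rw [Real.tan_eq_sin_div_cos, lt_div_iff₀ hc] at this
      exact this.le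
  have hc₀ : 0 ≤ cos (π * t) :=
    Real.cos_nonneg_of_mem_Icc ⟨by linarith [Real.pi_pos], hx'⟩
  have hsq : (π * t * cos (π * t)) ^ 2 ≤ sin (π * t) ^ 2 := by gcongr
  have h1 := Real.sin_sq_add_cos_sq (π * t)
  rw [cscSq, ← one_div, ← sub_nonneg]
  have : 1 + 1 / (π * t) ^ 2 - 1 / sin (π * t) ^ 2 =
      (sin (π * t) ^ 2 - (π * t * cos (π * t)) ^ 2) / ((π * t) ^ 2 * sin (π * t) ^ 2) := by
    rw [mul_pow (π * t), Real.cos_sq']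
    have := hx.ne'
    field_simp
    ring
  rw [this]
  exact div_nonneg (by linarith) (by positivity)

theorem cscSq_quartic_le_of_le_half {t : ℝ} (ht : 0 < t) (ht' : t ≤ 1 / 2) :
    6 * cscSq t ^ 2 - 4 * cscSq t ≤ 8 * cscSq t + 6 * (1 / (π * t) ^ 2) ^ 2 := by
  have h1 := cscSq_le_of_le_half ht ht'
  have h2 := inv_sq_le_cscSq ht (by linarith)
  have h3 : 0 ≤ 1 / (π * t) ^ 2 := by positivity
  nlinarith [mul_le_mul_of_nonneg_left h1 (cscSq_nonneg t), mul_le_mul_of_nonneg_left h1 h3]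

theorem cscSq_le {t : ℝ} (ht : 0 < t) (ht' : t < 1) :
    cscSq t ≤ 1 + 1 / π ^ 2 * (1 / t ^ 2 + 1 / (1 - t) ^ 2) := by
  have h1 : 0 ≤ 1 / π ^ 2 * (1 / t ^ 2) := by positivity
  have h2 : 0 ≤ 1 / π ^ 2 * (1 / (1 - t) ^ 2) := by positivity
  rw [mul_add]
  rcases le_total t (1 / 2) with h | h
  · have := cscSq_le_of_le_half ht h
    rw [mul_pow, ← one_div_mul_one_div] at this
    linarith
  · have := cscSq_le_of_le_half (t := 1 - t) (by linarith) (by linarith)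
    rw [mul_pow, ← one_div_mul_one_div, cscSq_one_sub] at this
    linarith

theorem cscSq_quartic_le {t : ℝ} (ht : 0 < t) (ht' : t < 1) :
    6 * cscSq t ^ 2 - 4 * cscSq t ≤
      8 * cscSq t + 6 / π ^ 4 * (1 / t ^ 4 + 1 / (1 - t) ^ 4) := by
  have h1 : 0 ≤ 6 / π ^ 4 * (1 / t ^ 4) := by positivity
  have h2 : 0 ≤ 6 / π ^ 4 * (1 / (1 - t) ^ 4) := by
    have := sub_pos.2 ht'
    positivity
  have key (x : ℝ) : 6 * (1 / (π * x) ^ 2) ^ 2 = 6 / π ^ 4 * (1 / x ^ 4) := by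
    rw [mul_pow, ← one_div_mul_one_div]
    ring
  rw [mul_add]
  rcases le_total t (1 / 2) with h | h
  · have := cscSq_quartic_le_of_le_half ht h
    rw [key] at this
    linarith
  · have := cscSq_quartic_le_of_le_half (t := 1 - t) (by linarith) (by linarith)
    rw [key, cscSq_one_sub] at this
    linarith

theorem sum_le_of_doubling {f g : ℝ → ℝ} {a Z δ : ℝ} {e : ℕ} (he : Even e) (ha : 0 ≤ a)
    (hper : Function.Periodic f 1)
    (hf : ∀ t : ℝ, (∀ z : ℤ, t ≠ z) → 2 ^ e * f t = f (t / 2) + f ((t + 1) / 2))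
    (hfg : ∀ y : ℝ, 0 < y → y < 1 → f y ≤ g y + a * (1 / y ^ e + 1 / (1 - y) ^ e))
    (hg : ∀ t : ℝ, 0 < t → t < 1 → Filter.Tendsto
      (fun m : ℕ => (∑ k ∈ Finset.range (2 ^ m), g ((t + k) / 2 ^ m)) / (2 ^ e) ^ m)
      Filter.atTop (nhds 0))
    (hZ : HasSum (fun n : ℕ => 1 / (n : ℝ) ^ e) Z)
    {ι : Type*} (s : Finset ι) (x : ι → ℝ) (hδ : 0 < δ)
    (hx : ∀ i ∈ s, ∀ p : ℤ, δ ≤ |x i + p|)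
    (hsep : ∀ i ∈ s, ∀ j ∈ s, i ≠ j → ∀ p : ℤ, δ ≤ |x i - x j + p|) :
    ∑ i ∈ s, f (x i) ≤ a * (2 * Z / δ ^ e) := by
  have hpos : ∀ i ∈ s, 0 < Int.fract (x i) := by
    intro i hi
    refine (Int.fract_nonneg _).lt_of_ne' fun h => ?_
    have h1 := hx i hi (-⌊x i⌋)
    rw [Int.cast_neg, ← sub_eq_add_neg, ← Int.fract, h, abs_zero] at h1
    linarith
  have hle_one : ∀ i ∈ s, δ ≤ 1 := by
    intro i hi
    have h1 := hx i hi (-⌊x i⌋)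
    rw [Int.cast_neg, ← sub_eq_add_neg, ← Int.fract, abs_of_pos (hpos i hi)] at h1
    linarith [Int.fract_lt_one (x i)]
  have hfract : ∀ i, f (x i) = f (Int.fract (x i)) := by
    intro i
    have := hper.sub_int_mul_eq (x := x i) ⌊x i⌋
    rw [mul_one] at this
    exact this.symm
  have hm : ∀ m : ℕ, ∑ i ∈ s, f (x i) ≤
      ∑ i ∈ s, (∑ k ∈ Finset.range (2 ^ m), g ((Int.fract (x i) + k) / 2 ^ m)) / (2 ^ e) ^ m +
        a * (2 * Z / δ ^ e) := by
    intro m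
    have hpts := sum_one_div_pow_le (s ×ˢ Finset.range (2 ^ m + 2 ^ m))
      (fun q => Int.fract (x q.1) + ((q.2 : ℤ) - 2 ^ m : ℤ)) hδ ?_ ?_ he hZ
    · rw [Finset.sum_product] at hpts
      refine le_trans (Finset.sum_le_sum fun i hi => ?_)
        (Finset.sum_add_distrib.trans_le (add_le_add_right
          (Finset.mul_sum _ _ _ |>.symm.trans_le (mul_le_mul_of_nonneg_left hpts ha)) _))
      rw [hfract]
      exact le_sum_of_doubling he hf hfg (hpos i hi) (Int.fract_lt_one _) m
    · rintro ⟨i, k⟩ hq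
      have h1 := hx i (Finset.mem_product.1 hq).1 (-⌊x i⌋ + ((k : ℤ) - 2 ^ m))
      rw [Int.cast_add, ← add_assoc, Int.cast_neg, ← sub_eq_add_neg] at h1
      exact h1
    · rintro ⟨i, k⟩ hq ⟨j, l⟩ hq' hne
      have hi := (Finset.mem_product.1 hq).1
      by_cases hij : i = j
      · subst hij
        have hkl : (k : ℤ) - l ≠ 0 := by
          intro h
          apply hne
          congr 1
          omega
        have h1 : (1 : ℝ) ≤ |((k - l : ℤ) : ℝ)| := by
          exact_mod_cast Int.one_le_abs hkl
        refine ((hle_one i hi).trans h1).trans_eq ?_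
        congr 1
        push_cast
        ring
      · refine (hsep i hi j (Finset.mem_product.1 hq').1 hij
          (⌊x j⌋ - ⌊x i⌋ + (k - l))).trans_eq ?_
        congr 1
        simp only [Int.fract]
        push_cast
        ring
  have hlim : Filter.Tendsto (fun m : ℕ =>
      ∑ i ∈ s, (∑ k ∈ Finset.range (2 ^ m), g ((Int.fract (x i) + k) / 2 ^ m)) / (2 ^ e) ^ m +
        a * (2 * Z / δ ^ e)) Filter.atTop (nhds (0 + a * (2 * Z / δ ^ e))) := by
    refine Filter.Tendsto.add_const _ ?_
    have := tendsto_finsetSum s fun i hi => hg _ (hpos i hi) (Int.fract_lt_one (x i))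
    rwa [Finset.sum_const_zero] at this
  rw [zero_add] at hlim
  exact ge_of_tendsto' hlim hm

theorem sum_cscSq_le {δ : ℝ} {ι : Type*} (s : Finset ι) (x : ι → ℝ) (hδ : 0 < δ)
    (hx : ∀ i ∈ s, ∀ p : ℤ, δ ≤ |x i + p|)
    (hsep : ∀ i ∈ s, ∀ j ∈ s, i ≠ j → ∀ p : ℤ, δ ≤ |x i - x j + p|) :
    ∑ i ∈ s, cscSq (x i) ≤ 1 / 3 / δ ^ 2 := by
  refine (sum_le_of_doubling (g := fun _ => 1) (a := 1 / π ^ 2) even_two (by positivity)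
    cscSq_periodic (fun t ht => ?_) (fun y => cscSq_le) (fun t _ _ => ?_) hasSum_zeta_two
    s x hδ hx hsep).trans_eq ?_
  · rw [← (cscSq_doubling ht).1]
    norm_num
  · convert! tendsto_pow_atTop_nhds_zero_of_lt_one (r := (1 / 2 : ℝ)) (by norm_num)
      (by norm_num) using 2 with m
    rw [Finset.sum_const, Finset.card_range, nsmul_one, Nat.cast_pow, Nat.cast_ofNat, ← div_pow]
    norm_num
  · field_simp
    norm_num

theorem sum_cscSq_quartic_le {δ : ℝ} {ι : Type*} (s : Finset ι) (x : ι → ℝ) (hδ : 0 < δ)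
    (hx : ∀ i ∈ s, ∀ p : ℤ, δ ≤ |x i + p|)
    (hsep : ∀ i ∈ s, ∀ j ∈ s, i ≠ j → ∀ p : ℤ, δ ≤ |x i - x j + p|) :
    ∑ i ∈ s, (6 * cscSq (x i) ^ 2 - 4 * cscSq (x i)) ≤ 2 / 15 / δ ^ 4 := by
  refine (sum_le_of_doubling (f := fun t => 6 * cscSq t ^ 2 - 4 * cscSq t)
    (g := fun t => 8 * cscSq t) (a := 6 / π ^ 4) (by decide) (by positivity)
    (fun t => by simp only [cscSq_periodic t]) (fun t ht => ?_) (fun y => cscSq_quartic_le)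
    (fun t ht₀ ht₁ => ?_) hasSum_zeta_four s x hδ hx hsep).trans_eq ?_
  · obtain ⟨h1, h2⟩ := cscSq_doubling ht
    have h3 : cscSq t = (cscSq (t / 2) + cscSq ((t + 1) / 2)) / 4 := by linarith
    rw [h3]
    linear_combination -12 * h2
  · have ht : ∀ z : ℤ, t ≠ z := by
      rintro z rfl
      have h₀ : 0 < z := by exact_mod_cast ht₀
      have h₁ : z < 1 := by exact_mod_cast ht₁
      omega
    have hlim := (tendsto_pow_atTop_nhds_zero_of_lt_one (r := (1 / 4 : ℝ)) (by norm_num)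
      (by norm_num)).const_mul (8 * cscSq t)
    rw [mul_zero] at hlim
    convert! hlim using 2 with m
    rw [← Finset.mul_sum, ← pow_mul_eq_sum_of_doubling (c := 4)
      (fun t ht => (cscSq_doubling ht).1) ht, one_div, inv_pow,
      show (2 : ℝ) ^ 4 = 4 * 4 by norm_num, mul_pow]
    field_simp
  · field_simp
    norm_num

theorem sum_Icc_neg_succ (g : ℤ → ℝ) (n : ℕ) :
    ∑ k ∈ Finset.Icc (-((n + 1 : ℕ) : ℤ)) (n + 1 : ℕ), g k =
      ∑ k ∈ Finset.Icc (-(n : ℤ)) n, g k + g (n + 1) + g (-(n + 1)) := by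
  have h : Finset.Icc (-((n + 1 : ℕ) : ℤ)) (n + 1 : ℕ) =
      insert (-((n : ℤ) + 1)) (insert ((n : ℤ) + 1) (Finset.Icc (-(n : ℤ)) n)) := by
    ext k
    simp only [Finset.mem_Icc, Finset.mem_insert]
    push_cast
    omega
  rw [h, Finset.sum_insert, Finset.sum_insert]
  · ring
  · simp
  · simp only [Finset.mem_Icc, Finset.mem_insert]
    omega

theorem sum_Icc_neg_weighted_succ (g : ℤ → ℝ) (n : ℕ) :
    ∑ k ∈ Finset.Icc (-((n + 1 : ℕ) : ℤ)) (n + 1 : ℕ), (((n + 1 : ℕ) : ℝ) + 1 - |(k : ℝ)|) * g k =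
      ∑ k ∈ Finset.Icc (-(n : ℤ)) n, ((n : ℝ) + 1 - |(k : ℝ)|) * g k +
        ∑ k ∈ Finset.Icc (-((n + 1 : ℕ) : ℤ)) (n + 1 : ℕ), g k := by
  have habs : |(n : ℝ) + 1| = n + 1 := abs_of_pos (by positivity)
  have habs' : |-((n : ℝ) + 1)| = n + 1 := by rw [abs_neg, habs]
  rw [sum_Icc_neg_succ, sum_Icc_neg_succ g, ← add_assoc, ← add_assoc, ← Finset.sum_add_distrib]
  congr 1
  · congr 1
    · refine Finset.sum_congr rfl fun k _ => ?_
      push_cast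
      ring
    · push_cast
      rw [habs]
      ring
  · push_cast
    rw [habs']
    ring

theorem sum_cos_mul_one_sub_cos (θ : ℝ) (n : ℕ) :
    (∑ k ∈ Finset.Icc (-(n : ℤ)) n, cos (k * θ)) * (1 - cos θ) =
      cos (n * θ) - cos ((n + 1) * θ) := by
  induction n with
  | zero => simp
  | succ n ih =>
    rw [sum_Icc_neg_succ, add_assoc, add_mul, ih]
    push_cast
    rw [neg_mul, Real.cos_neg]
    have h : cos ((n + 1 + 1) * θ) = 2 * cos ((n + 1) * θ) * cos θ - cos (n * θ) := by
      have h1 : ((n : ℝ) + 1 + 1) * θ = (n + 1) * θ + θ := by ring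
      have h2 : (n : ℝ) * θ = (n + 1) * θ - θ := by ring
      rw [h1, h2, Real.cos_add, Real.cos_sub]
      ring
    rw [h]
    ring

theorem sum_weighted_cos_mul_one_sub_cos (θ : ℝ) (n : ℕ) :
    (∑ k ∈ Finset.Icc (-(n : ℤ)) n, ((n : ℝ) + 1 - |(k : ℝ)|) * cos (k * θ)) * (1 - cos θ) =
      1 - cos ((n + 1) * θ) := by
  induction n with
  | zero => simp
  | succ n ih =>
    rw [sum_Icc_neg_weighted_succ (fun k => cos (k * θ)), add_mul, ih, sum_cos_mul_one_sub_cos]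
    push_cast
    ring

theorem sum_Icc_neg_sq (n : ℕ) :
    ∑ k ∈ Finset.Icc (-(n : ℤ)) n, (k : ℝ) ^ 2 =
      (n : ℝ) * (n + 1) * (2 * n + 1) / 3 := by
  induction n with
  | zero => simp
  | succ n ih =>
    rw [sum_Icc_neg_succ (fun k => (k : ℝ) ^ 2), ih]
    push_cast
    ring

theorem sum_Icc_neg_weighted_sq (n : ℕ) :
    ∑ k ∈ Finset.Icc (-(n : ℤ)) n, ((n : ℝ) + 1 - |(k : ℝ)|) * (k : ℝ) ^ 2 =
      (n : ℝ) * (n + 1) ^ 2 * (n + 2) / 6 := by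
  induction n with
  | zero => simp
  | succ n ih =>
    rw [sum_Icc_neg_weighted_succ (fun k => (k : ℝ) ^ 2), ih, sum_Icc_neg_sq]
    push_cast
    ring

theorem fejer_eq_sum (n : ℕ) (t : ℝ) :
    fejer n t = 1 / ((n : ℝ) + 1) ^ 2 *
      ∑ k ∈ Finset.Icc (-(n : ℤ)) n, ((n : ℝ) + 1 - |(k : ℝ)|) * cos (k * (2 * π * t)) := by
  rw [fejer, Finset.mul_sum, Finset.mul_sum]
  refine Finset.sum_congr rfl fun k _ => ?_
  rw [show 2 * π * k * t = k * (2 * π * t) by ring]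
  field_simp

theorem fejer_eq_sin_sq_mul_cscSq (n : ℕ) {t : ℝ} (ht : ∀ z : ℤ, t ≠ z) :
    fejer n t = 1 / ((n : ℝ) + 1) ^ 2 * (sin (π * (n + 1) * t) ^ 2 * cscSq t) := by
  have hs := sin_pi_mul_ne_zero_of_ne_int ht
  have h := sum_weighted_cos_mul_one_sub_cos (2 * π * t) n
  have h1 (x : ℝ) : 1 - cos (2 * x) = 2 * sin x ^ 2 := by
    rw [Real.cos_two_mul, Real.cos_sq']
    ring
  rw [show ((n : ℝ) + 1) * (2 * π * t) = 2 * (π * (n + 1) * t) by ring, mul_assoc 2 π, h1, h1] at h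
  rw [fejer_eq_sum, cscSq, mul_assoc 2 π]
  congr 1
  rw [← div_eq_mul_inv, eq_div_iff (pow_ne_zero 2 hs)]
  linarith

theorem hasDerivAt_fejer (n : ℕ) (t : ℝ) :
    HasDerivAt (fejer n) (1 / ((n : ℝ) + 1) ^ 2 * ∑ k ∈ Finset.Icc (-(n : ℤ)) n,
      ((n : ℝ) + 1 - |(k : ℝ)|) * (-sin (k * (2 * π * t)) * (k * (2 * π)))) t := by
  rw [funext (fejer_eq_sum n)]
  refine (HasDerivAt.fun_sum fun k _ => HasDerivAt.const_mul _ ?_).const_mul _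
  have h : HasDerivAt (fun t : ℝ => (k : ℝ) * (2 * π * t)) (k * (2 * π)) t := by
    simpa using ((hasDerivAt_id t).const_mul (2 * π)).const_mul (k : ℝ)
  exact h.cos

theorem fejer_neg (n : ℕ) (t : ℝ) : fejer n (-t) = fejer n t := by
  simp only [fejer, mul_neg, Real.cos_neg]

theorem deriv_fejer_neg (n : ℕ) (t : ℝ) : deriv (fejer n) (-t) = -deriv (fejer n) t := by
  have h := deriv_comp_neg (fejer n) t
  simp only [fejer_neg] at h
  rw [h, neg_neg]

theorem fejer_zero (n : ℕ) : fejer n 0 = 1 := by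
  have key : ∀ m : ℕ, ∑ k ∈ Finset.Icc (-(m : ℤ)) m, ((m : ℝ) + 1 - |(k : ℝ)|) * 1 =
      ((m : ℝ) + 1) ^ 2 := by
    intro m
    induction m with
    | zero => simp
    | succ m ih =>
      rw [sum_Icc_neg_weighted_succ (fun _ => 1), ih, Finset.sum_const, Int.card_Icc,
        show (((m + 1 : ℕ) : ℤ) + 1 - -((m + 1 : ℕ) : ℤ)).toNat = 2 * m + 3 by omega]
      push_cast
      ring
  have h : ((n : ℝ) + 1) ^ 2 ≠ 0 := by positivity
  rw [fejer_eq_sum]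
  simp only [mul_zero, Real.cos_zero]
  rw [key, one_div_mul_cancel h]

theorem iteratedDeriv_two_fejer_zero (n : ℕ) :
    iteratedDeriv 2 (fejer n) 0 = -(2 / 3 * π ^ 2 * n * (n + 2)) := by
  have h1 : deriv (fejer n) = fun t => 1 / ((n : ℝ) + 1) ^ 2 * ∑ k ∈ Finset.Icc (-(n : ℤ)) n,
      ((n : ℝ) + 1 - |(k : ℝ)|) * (-sin (k * (2 * π * t)) * (k * (2 * π))) :=
    funext fun t => (hasDerivAt_fejer n t).deriv
  rw [iteratedDeriv_succ, iteratedDeriv_one, h1]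
  have h2 : HasDerivAt (fun t => 1 / ((n : ℝ) + 1) ^ 2 * ∑ k ∈ Finset.Icc (-(n : ℤ)) n,
      ((n : ℝ) + 1 - |(k : ℝ)|) * (-sin (k * (2 * π * t)) * (k * (2 * π))))
      (1 / ((n : ℝ) + 1) ^ 2 * ∑ k ∈ Finset.Icc (-(n : ℤ)) n,
        ((n : ℝ) + 1 - |(k : ℝ)|) * (-(cos (k * (2 * π * 0)) * (k * (2 * π))) * (k * (2 * π))))
      0 := by
    refine (HasDerivAt.fun_sum fun k _ => HasDerivAt.const_mul _ ?_).const_mul _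
    have h : HasDerivAt (fun t : ℝ => (k : ℝ) * (2 * π * t)) (k * (2 * π)) 0 := by
      simpa using ((hasDerivAt_id (0 : ℝ)).const_mul (2 * π)).const_mul (k : ℝ)
    exact h.sin.neg.mul_const _
  rw [h2.deriv]
  have h3 : ∑ k ∈ Finset.Icc (-(n : ℤ)) n, ((n : ℝ) + 1 - |(k : ℝ)|) *
      (-(cos (k * (2 * π * 0)) * (k * (2 * π))) * (k * (2 * π))) =
      -(4 * π ^ 2) * ∑ k ∈ Finset.Icc (-(n : ℤ)) n, ((n : ℝ) + 1 - |(k : ℝ)|) * (k : ℝ) ^ 2 := by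
    rw [Finset.mul_sum]
    refine Finset.sum_congr rfl fun k _ => ?_
    rw [mul_zero, mul_zero, Real.cos_zero]
    ring
  rw [h3, sum_Icc_neg_weighted_sq]
  field_simp
  ring

/-- The derivative of `cscSq`. -/
noncomputable def cscSqDeriv (t : ℝ) : ℝ := -(2 * π * cos (π * t)) / sin (π * t) ^ 3

theorem hasDerivAt_cscSq {t : ℝ} (ht : ∀ z : ℤ, t ≠ z) :
    HasDerivAt cscSq (cscSqDeriv t) t := by
  have hs := sin_pi_mul_ne_zero_of_ne_int ht
  have h : HasDerivAt (fun t : ℝ => π * t) π t := by simpa using (hasDerivAt_id t).const_mul π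
  refine ((h.sin.fun_pow 2).fun_inv (pow_ne_zero 2 hs)).congr_deriv ?_
  rw [cscSqDeriv]
  push_cast
  field_simp

theorem hasDerivAt_cscSqDeriv {t : ℝ} (ht : ∀ z : ℤ, t ≠ z) :
    HasDerivAt cscSqDeriv (π ^ 2 * (6 * cscSq t ^ 2 - 4 * cscSq t)) t := by
  have hs := sin_pi_mul_ne_zero_of_ne_int ht
  have h : HasDerivAt (fun t : ℝ => π * t) π t := by simpa using (hasDerivAt_id t).const_mul π
  refine (((h.cos.const_mul (2 * π)).fun_neg).fun_div (h.sin.fun_pow 3)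
    (pow_ne_zero 3 hs)).congr_deriv ?_
  rw [cscSq]
  have h1 := Real.cos_sq' (π * t)
  field_simp
  rw [show π * t = t * π by ring] at h1 ⊢
  push_cast
  ring_nf
  rw [mul_comm t π] at h1 ⊢
  simp only [h1]
  ring

theorem cscSqDeriv_sq {t : ℝ} (ht : ∀ z : ℤ, t ≠ z) :
    cscSqDeriv t ^ 2 = 4 * π ^ 2 * (cscSq t ^ 3 - cscSq t ^ 2) := by
  have hs := sin_pi_mul_ne_zero_of_ne_int ht
  rw [cscSqDeriv, cscSq, div_pow, neg_sq, mul_pow, Real.cos_sq']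
  field_simp
  ring

theorem abs_cscSqDeriv_le {t δ : ℝ} (hδ : 0 < δ) (ht : ∀ z : ℤ, t ≠ z) :
    |cscSqDeriv t| ≤ cscSq t / δ + π ^ 2 / 6 * δ * (6 * cscSq t ^ 2 - 4 * cscSq t) := by
  have h1 := one_le_cscSq ht
  have hw : 0 ≤ 6 * cscSq t ^ 2 - 4 * cscSq t := by nlinarith
  have hw' : 0 ≤ π ^ 2 / 6 * δ * (6 * cscSq t ^ 2 - 4 * cscSq t) := by positivity
  have hu : 0 ≤ cscSq t / δ := by positivity
  refine abs_le_of_sq_le_sq ?_ (by positivity)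
  have hprod : cscSq t / δ * (π ^ 2 / 6 * δ * (6 * cscSq t ^ 2 - 4 * cscSq t)) =
      π ^ 2 * (cscSq t ^ 3 - 2 / 3 * cscSq t ^ 2) := by
    field_simp
    ring
  have hsq : 0 ≤ π ^ 2 * cscSq t ^ 2 := by positivity
  rw [cscSqDeriv_sq ht]
  nlinarith [sq_nonneg (cscSq t / δ - π ^ 2 / 6 * δ * (6 * cscSq t ^ 2 - 4 * cscSq t))]

theorem eventually_ne_int {t : ℝ} (ht : ∀ z : ℤ, t ≠ z) : ∀ᶠ y : ℝ in nhds t, ∀ z : ℤ, y ≠ z := by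
  have hs := sin_pi_mul_ne_zero_of_ne_int ht
  have hc : ContinuousAt (fun y => sin (π * y)) t := by fun_prop
  filter_upwards [hc.eventually_ne hs] with y hy z hz
  rw [hz, mul_comm, Real.sin_int_mul_pi] at hy
  exact hy rfl

theorem deriv_fejer_eq (n : ℕ) {t : ℝ} (ht : ∀ z : ℤ, t ≠ z) :
    deriv (fejer n) t = 1 / ((n : ℝ) + 1) ^ 2 * (π * (n + 1) * sin (2 * (π * (n + 1) * t)) *
      cscSq t + sin (π * (n + 1) * t) ^ 2 * cscSqDeriv t) := by
  have hev : fejer n =ᶠ[nhds t]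
      fun y => 1 / ((n : ℝ) + 1) ^ 2 * (sin (π * (n + 1) * y) ^ 2 * cscSq y) := by
    filter_upwards [eventually_ne_int ht] with y hy using fejer_eq_sin_sq_mul_cscSq n hy
  have h : HasDerivAt (fun t : ℝ => π * (n + 1) * t) (π * (n + 1)) t := by
    simpa using (hasDerivAt_id t).const_mul (π * ((n : ℝ) + 1))
  rw [hev.deriv_eq, (((h.sin.fun_pow 2).fun_mul (hasDerivAt_cscSq ht)).const_mul _).deriv,
    Real.sin_two_mul]
  push_cast
  ring

theorem iteratedDeriv_two_fejer_eq (n : ℕ) {t : ℝ} (ht : ∀ z : ℤ, t ≠ z) :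
    iteratedDeriv 2 (fejer n) t = 1 / ((n : ℝ) + 1) ^ 2 *
      (2 * π ^ 2 * (n + 1) ^ 2 * cos (2 * (π * (n + 1) * t)) * cscSq t +
        2 * π * (n + 1) * sin (2 * (π * (n + 1) * t)) * cscSqDeriv t +
        sin (π * (n + 1) * t) ^ 2 * (π ^ 2 * (6 * cscSq t ^ 2 - 4 * cscSq t))) := by
  have hev : deriv (fejer n) =ᶠ[nhds t] fun t => 1 / ((n : ℝ) + 1) ^ 2 * (π * (n + 1) *
      sin (2 * (π * (n + 1) * t)) * cscSq t + sin (π * (n + 1) * t) ^ 2 * cscSqDeriv t) := by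
    filter_upwards [eventually_ne_int ht] with y hy using deriv_fejer_eq n hy
  have h : HasDerivAt (fun t : ℝ => π * (n + 1) * t) (π * (n + 1)) t := by
    simpa using (hasDerivAt_id t).const_mul (π * ((n : ℝ) + 1))
  rw [iteratedDeriv_succ, iteratedDeriv_one, hev.deriv_eq,
    (((((h.const_mul 2).sin.const_mul (π * ((n : ℝ) + 1))).fun_mul (hasDerivAt_cscSq ht)).fun_add
      ((h.sin.fun_pow 2).fun_mul (hasDerivAt_cscSqDeriv ht))).const_mul _).deriv,
    Real.sin_two_mul]
  push_cast
  ring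

theorem abs_fejer_le (n : ℕ) {t : ℝ} (ht : ∀ z : ℤ, t ≠ z) :
    |fejer n t| ≤ 1 / ((n : ℝ) + 1) ^ 2 * cscSq t := by
  have h0 := cscSq_nonneg t
  rw [fejer_eq_sin_sq_mul_cscSq n ht, abs_of_nonneg (by positivity)]
  gcongr
  exact mul_le_of_le_one_left h0 (Real.sin_sq_le_one _)

theorem abs_deriv_fejer_le (n : ℕ) {t : ℝ} (ht : ∀ z : ℤ, t ≠ z) :
    |deriv (fejer n) t| ≤
      1 / ((n : ℝ) + 1) ^ 2 * (π * (n + 1) * cscSq t + |cscSqDeriv t|) := by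
  have h0 := cscSq_nonneg t
  have h1 : 0 ≤ π * ((n : ℝ) + 1) := by positivity
  rw [deriv_fejer_eq n ht, abs_mul, abs_of_nonneg (by positivity : 0 ≤ 1 / ((n : ℝ) + 1) ^ 2)]
  gcongr
  refine (abs_add_le _ _).trans (add_le_add ?_ ?_)
  · rw [abs_mul, abs_mul, abs_of_nonneg h0, abs_of_nonneg h1]
    exact mul_le_mul_of_nonneg_right (mul_le_of_le_one_right h1 (Real.abs_sin_le_one _)) h0
  · rw [abs_mul, abs_of_nonneg (sq_nonneg _)]
    exact mul_le_of_le_one_left (abs_nonneg _) (Real.sin_sq_le_one _)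

theorem abs_iteratedDeriv_two_fejer_le (n : ℕ) {t : ℝ} (ht : ∀ z : ℤ, t ≠ z) :
    |iteratedDeriv 2 (fejer n) t| ≤ 1 / ((n : ℝ) + 1) ^ 2 *
      (2 * π ^ 2 * (n + 1) ^ 2 * cscSq t + 2 * π * (n + 1) * |cscSqDeriv t| +
        π ^ 2 * (6 * cscSq t ^ 2 - 4 * cscSq t)) := by
  have h0 := cscSq_nonneg t
  have h1 : 0 ≤ 2 * π * ((n : ℝ) + 1) := by positivity
  have h2 : 0 ≤ 2 * π ^ 2 * ((n : ℝ) + 1) ^ 2 := by positivity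
  have h3 : 0 ≤ π ^ 2 * (6 * cscSq t ^ 2 - 4 * cscSq t) :=
    mul_nonneg (by positivity) (by nlinarith [one_le_cscSq ht])
  rw [iteratedDeriv_two_fejer_eq n ht, abs_mul,
    abs_of_nonneg (by positivity : 0 ≤ 1 / ((n : ℝ) + 1) ^ 2)]
  gcongr
  refine (abs_add_three _ _ _).trans (add_le_add (add_le_add ?_ ?_) ?_)
  · rw [abs_mul, abs_mul, abs_of_nonneg h0, abs_of_nonneg h2]
    exact mul_le_mul_of_nonneg_right (mul_le_of_le_one_right h2 (Real.abs_cos_le_one _)) h0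
  · rw [abs_mul, abs_mul, abs_of_nonneg h1]
    exact mul_le_mul_of_nonneg_right (mul_le_of_le_one_right h1 (Real.abs_sin_le_one _))
      (abs_nonneg _)
  · rw [abs_mul, abs_of_nonneg (sq_nonneg _), abs_of_nonneg h3]
    exact mul_le_of_le_one_left h3 (Real.sin_sq_le_one _)

section SeparatedSums

variable {ι : Type*} {s : Finset ι} {x : ι → ℝ} {δ : ℝ}

theorem ne_int_of_le_abs_add {t : ℝ} (hδ : 0 < δ) (ht : ∀ p : ℤ, δ ≤ |t + p|) (z : ℤ) :
    t ≠ z := by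
  rintro rfl
  have := ht (-z)
  rw [Int.cast_neg, add_neg_cancel, abs_zero] at this
  linarith

theorem sum_abs_cscSqDeriv_le (hδ : 0 < δ) (hx : ∀ i ∈ s, ∀ p : ℤ, δ ≤ |x i + p|)
    (hsep : ∀ i ∈ s, ∀ j ∈ s, i ≠ j → ∀ p : ℤ, δ ≤ |x i - x j + p|) :
    ∑ i ∈ s, |cscSqDeriv (x i)| ≤ 8 / π ^ 2 / δ ^ 3 := by
  have h1 := sum_cscSq_le s x hδ hx hsep
  have h2 := sum_cscSq_quartic_le s x hδ hx hsep
  have hpi' : π ^ 2 ≤ 3.15 ^ 2 := by gcongr; exact Real.pi_lt_d2.le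
  calc ∑ i ∈ s, |cscSqDeriv (x i)| ≤ ∑ i ∈ s, (cscSq (x i) / δ +
        π ^ 2 / 6 * δ * (6 * cscSq (x i) ^ 2 - 4 * cscSq (x i))) :=
        Finset.sum_le_sum fun i hi =>
          abs_cscSqDeriv_le hδ (ne_int_of_le_abs_add hδ (hx i hi))
    _ = (∑ i ∈ s, cscSq (x i)) / δ +
        π ^ 2 / 6 * δ * ∑ i ∈ s, (6 * cscSq (x i) ^ 2 - 4 * cscSq (x i)) := by
        rw [Finset.sum_add_distrib, Finset.sum_div, Finset.mul_sum]
    _ ≤ 1 / 3 / δ ^ 2 / δ + π ^ 2 / 6 * δ * (2 / 15 / δ ^ 4) := by gcongr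
    _ = (1 / 3 + π ^ 2 / 45) / δ ^ 3 := by
        field_simp
        ring
    _ ≤ 8 / π ^ 2 / δ ^ 3 := by
        gcongr
        rw [le_div_iff₀ (by positivity)]
        nlinarith

theorem sum_abs_fejer_le (n : ℕ) (hδ : 0 < δ) (hx : ∀ i ∈ s, ∀ p : ℤ, δ ≤ |x i + p|)
    (hsep : ∀ i ∈ s, ∀ j ∈ s, i ≠ j → ∀ p : ℤ, δ ≤ |x i - x j + p|) :
    ∑ i ∈ s, |fejer n (x i)| ≤ 4 / π ^ 2 * (((n : ℝ) + 1) * δ)⁻¹ ^ 2 := by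
  have h1 := sum_cscSq_le s x hδ hx hsep
  have hpi' : π ^ 2 ≤ 3.15 ^ 2 := by gcongr; exact Real.pi_lt_d2.le
  calc ∑ i ∈ s, |fejer n (x i)| ≤ ∑ i ∈ s, 1 / ((n : ℝ) + 1) ^ 2 * cscSq (x i) :=
        Finset.sum_le_sum fun i hi =>
          abs_fejer_le n (ne_int_of_le_abs_add hδ (hx i hi))
    _ ≤ 1 / ((n : ℝ) + 1) ^ 2 * (1 / 3 / δ ^ 2) := by
        rw [← Finset.mul_sum]
        gcongr
    _ = 1 / 3 * (((n : ℝ) + 1) * δ)⁻¹ ^ 2 := by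
        field_simp
    _ ≤ 4 / π ^ 2 * (((n : ℝ) + 1) * δ)⁻¹ ^ 2 := by
        gcongr ?_ * _
        rw [le_div_iff₀ (by positivity)]
        linarith

theorem sum_abs_deriv_fejer_le (n : ℕ) (hδ : 0 < δ) (hx : ∀ i ∈ s, ∀ p : ℤ, δ ≤ |x i + p|)
    (hsep : ∀ i ∈ s, ∀ j ∈ s, i ≠ j → ∀ p : ℤ, δ ≤ |x i - x j + p|) :
    ∑ i ∈ s, |deriv (fejer n) (x i)| ≤ ((n : ℝ) + 1) *
      (4 / π + 8 / π ^ 2 * (((n : ℝ) + 1) * δ)⁻¹) * (((n : ℝ) + 1) * δ)⁻¹ ^ 2 := by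
  have h1 := sum_cscSq_le s x hδ hx hsep
  have h2 := sum_abs_cscSqDeriv_le hδ hx hsep
  have hpi' : π ^ 2 ≤ 3.15 ^ 2 := by gcongr; exact Real.pi_lt_d2.le
  calc ∑ i ∈ s, |deriv (fejer n) (x i)| ≤ ∑ i ∈ s, 1 / ((n : ℝ) + 1) ^ 2 *
        (π * (n + 1) * cscSq (x i) + |cscSqDeriv (x i)|) :=
        Finset.sum_le_sum fun i hi =>
          abs_deriv_fejer_le n (ne_int_of_le_abs_add hδ (hx i hi))
    _ ≤ 1 / ((n : ℝ) + 1) ^ 2 * (π * (n + 1) * (1 / 3 / δ ^ 2) + 8 / π ^ 2 / δ ^ 3) := by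
        rw [← Finset.mul_sum, Finset.sum_add_distrib, ← Finset.mul_sum]
        gcongr
    _ = ((n : ℝ) + 1) * (π / 3 + 8 / π ^ 2 * (((n : ℝ) + 1) * δ)⁻¹) *
        (((n : ℝ) + 1) * δ)⁻¹ ^ 2 := by
        field_simp
    _ ≤ _ := by
        gcongr _ * (?_ + _) * _
        rw [le_div_iff₀ Real.pi_pos]
        linarith

theorem sum_abs_iteratedDeriv_two_fejer_le (n : ℕ) (hδ : 0 < δ)
    (hx : ∀ i ∈ s, ∀ p : ℤ, δ ≤ |x i + p|)
    (hsep : ∀ i ∈ s, ∀ j ∈ s, i ≠ j → ∀ p : ℤ, δ ≤ |x i - x j + p|) :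
    ∑ i ∈ s, |iteratedDeriv 2 (fejer n) (x i)| ≤ ((n : ℝ) + 1) ^ 2 *
      (80 / 9 + 16 / π * (((n : ℝ) + 1) * δ)⁻¹ + 64 / (3 * π ^ 2) * (((n : ℝ) + 1) * δ)⁻¹ ^ 2) *
        (((n : ℝ) + 1) * δ)⁻¹ ^ 2 := by
  have h1 := sum_cscSq_le s x hδ hx hsep
  have h2 := sum_abs_cscSqDeriv_le hδ hx hsep
  have h3 := sum_cscSq_quartic_le s x hδ hx hsep
  have hpi' : π ^ 2 ≤ 3.15 ^ 2 := by gcongr; exact Real.pi_lt_d2.le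
  calc ∑ i ∈ s, |iteratedDeriv 2 (fejer n) (x i)| ≤ ∑ i ∈ s, 1 / ((n : ℝ) + 1) ^ 2 *
        (2 * π ^ 2 * (n + 1) ^ 2 * cscSq (x i) + 2 * π * (n + 1) * |cscSqDeriv (x i)| +
          π ^ 2 * (6 * cscSq (x i) ^ 2 - 4 * cscSq (x i))) :=
        Finset.sum_le_sum fun i hi =>
          abs_iteratedDeriv_two_fejer_le n (ne_int_of_le_abs_add hδ (hx i hi))
    _ ≤ 1 / ((n : ℝ) + 1) ^ 2 * (2 * π ^ 2 * (n + 1) ^ 2 * (1 / 3 / δ ^ 2) +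
        2 * π * (n + 1) * (8 / π ^ 2 / δ ^ 3) + π ^ 2 * (2 / 15 / δ ^ 4)) := by
        rw [← Finset.mul_sum, Finset.sum_add_distrib, Finset.sum_add_distrib, ← Finset.mul_sum,
          ← Finset.mul_sum, ← Finset.mul_sum]
        gcongr
    _ = ((n : ℝ) + 1) ^ 2 * (2 * π ^ 2 / 3 + 16 / π * (((n : ℝ) + 1) * δ)⁻¹ +
        2 * π ^ 2 / 15 * (((n : ℝ) + 1) * δ)⁻¹ ^ 2) * (((n : ℝ) + 1) * δ)⁻¹ ^ 2 := by
        field_simp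
        ring
    _ ≤ _ := by
        gcongr _ * (?_ + _ + ?_ * _) * _
        · linarith
        · rw [le_div_iff₀ (by positivity)]
          nlinarith [sq_nonneg π]

end SeparatedSums

theorem sep_le_abs {r : ℕ} (τ : Fin r → ℝ) {i j : Fin r} (hij : i ≠ j) (p : ℤ) :
    sep τ ≤ |τ i - τ j + p| := by
  refine csInf_le ⟨0, ?_⟩ ⟨i, j, p, hij, rfl⟩
  rintro _ ⟨_, _, _, _, rfl⟩
  exact abs_nonneg _

theorem sq_div_curvature_le {n : ℕ} (hn : 2 ≤ n) :
    ((n : ℝ) + 1) ^ 2 / (2 / 3 * π ^ 2 * n * (n + 2)) ≤ 27 / (16 * π ^ 2) := by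
  have hn' : (2 : ℝ) ≤ n := by exact_mod_cast hn
  rw [div_le_div_iff₀ (by positivity) (by positivity)]
  have : (0 : ℝ) ≤ n ^ 2 + 2 * n - 8 := by nlinarith
  nlinarith [mul_nonneg (sq_nonneg π) this]

theorem div_sqrt_curvature_le {n : ℕ} (hn : 2 ≤ n) :
    ((n : ℝ) + 1) / √(2 / 3 * π ^ 2 * n * (n + 2)) ≤ 3 * √3 / (4 * π) := by
  refine le_of_sq_le_sq ?_ (by positivity)
  rw [div_pow, Real.sq_sqrt (by positivity), div_pow, mul_pow, mul_pow, Real.sq_sqrt (by norm_num)]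
  refine (sq_div_curvature_le hn).trans_eq ?_
  norm_num

theorem deriv_fejer_zero (n : ℕ) : deriv (fejer n) 0 = 0 := by
  have h := deriv_fejer_neg n 0
  rw [neg_zero] at h
  linarith

section DmatRows

variable {n r : ℕ} {τ : Fin r → ℝ} (i : Fin r)

theorem sep_le_abs_sub_of_mem_erase : ∀ j ∈ Finset.univ.erase i, ∀ p : ℤ,
    sep τ ≤ |τ i - τ j + p| :=
  fun _ hj p => sep_le_abs τ (Finset.ne_of_mem_erase hj).symm p

theorem sep_le_abs_sub_sub_of_mem_erase : ∀ j ∈ Finset.univ.erase i,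
    ∀ k ∈ Finset.univ.erase i, j ≠ k → ∀ p : ℤ, sep τ ≤ |τ i - τ j - (τ i - τ k) + p| := by
  intro j _ k _ hjk p
  rw [sub_sub_sub_cancel_left]
  exact sep_le_abs τ hjk.symm p

theorem sum_abs_fejer_sub_one_le (hτ : 0 < sep τ) :
    ∑ j, |fejer n (τ i - τ j) - (1 : Matrix (Fin r) (Fin r) ℝ) i j| ≤
      4 / π ^ 2 * (((n : ℝ) + 1) * sep τ)⁻¹ ^ 2 := by
  rw [← Finset.sum_erase (a := i) Finset.univ (by simp [fejer_zero])]
  refine (Finset.sum_le_sum fun j hj => ?_).trans (sum_abs_fejer_le n hτ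
    (sep_le_abs_sub_of_mem_erase i) (sep_le_abs_sub_sub_of_mem_erase i))
  rw [Matrix.one_apply_ne (Finset.ne_of_mem_erase hj).symm, sub_zero]

theorem sum_abs_deriv_fejer_div_le (hn : 2 ≤ n) (hτ : 0 < sep τ) :
    ∑ j, |-(deriv (fejer n) (τ i - τ j)) / √(-(iteratedDeriv 2 (fejer n) 0))| ≤
      3 * √3 / (4 * π) * (4 / π + 8 / π ^ 2 * (((n : ℝ) + 1) * sep τ)⁻¹) *
        (((n : ℝ) + 1) * sep τ)⁻¹ ^ 2 := by
  rw [← Finset.sum_erase (a := i) Finset.univ (by simp [deriv_fejer_zero]),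
    iteratedDeriv_two_fejer_zero, neg_neg]
  simp only [abs_div, abs_neg, abs_of_nonneg (Real.sqrt_nonneg _)]
  rw [← Finset.sum_div]
  calc _ ≤ _ := div_le_div_of_nonneg_right (sum_abs_deriv_fejer_le n hτ
        (sep_le_abs_sub_of_mem_erase i) (sep_le_abs_sub_sub_of_mem_erase i)) (Real.sqrt_nonneg _)
    _ = ((n : ℝ) + 1) / √(2 / 3 * π ^ 2 * n * (n + 2)) *
        (4 / π + 8 / π ^ 2 * (((n : ℝ) + 1) * sep τ)⁻¹) * (((n : ℝ) + 1) * sep τ)⁻¹ ^ 2 := by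
        ring
    _ ≤ _ := by
        gcongr ?_ * _ * _
        exact div_sqrt_curvature_le hn

theorem sum_abs_iteratedDeriv_two_fejer_div_sub_one_le (hn : 2 ≤ n) (hτ : 0 < sep τ) :
    ∑ j, |iteratedDeriv 2 (fejer n) (τ i - τ j) / iteratedDeriv 2 (fejer n) 0 -
        (1 : Matrix (Fin r) (Fin r) ℝ) i j| ≤
      27 / (16 * π ^ 2) * (80 / 9 + 16 / π * (((n : ℝ) + 1) * sep τ)⁻¹ +
        64 / (3 * π ^ 2) * (((n : ℝ) + 1) * sep τ)⁻¹ ^ 2) * (((n : ℝ) + 1) * sep τ)⁻¹ ^ 2 := by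
  have hcurv : 0 < 2 / 3 * π ^ 2 * n * ((n : ℝ) + 2) := by
    have : (0 : ℝ) < n := by exact_mod_cast (by omega : 0 < n)
    positivity
  have hne : iteratedDeriv 2 (fejer n) 0 ≠ 0 := by
    rw [iteratedDeriv_two_fejer_zero]
    exact neg_ne_zero.2 hcurv.ne'
  rw [← Finset.sum_erase (a := i) Finset.univ (by simp [div_self hne])]
  calc _ = (∑ j ∈ Finset.univ.erase i, |iteratedDeriv 2 (fejer n) (τ i - τ j)|) /
        (2 / 3 * π ^ 2 * n * (n + 2)) := by
        rw [Finset.sum_div]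
        refine Finset.sum_congr rfl fun j hj => ?_
        rw [Matrix.one_apply_ne (Finset.ne_of_mem_erase hj).symm, sub_zero, abs_div,
          iteratedDeriv_two_fejer_zero, abs_neg, abs_of_pos hcurv]
    _ ≤ _ := div_le_div_of_nonneg_right (sum_abs_iteratedDeriv_two_fejer_le n hτ
        (sep_le_abs_sub_of_mem_erase i) (sep_le_abs_sub_sub_of_mem_erase i)) hcurv.le
    _ = ((n : ℝ) + 1) ^ 2 / (2 / 3 * π ^ 2 * n * (n + 2)) *
        (80 / 9 + 16 / π * (((n : ℝ) + 1) * sep τ)⁻¹ +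
          64 / (3 * π ^ 2) * (((n : ℝ) + 1) * sep τ)⁻¹ ^ 2) *
            (((n : ℝ) + 1) * sep τ)⁻¹ ^ 2 := by
        ring
    _ ≤ _ := by
        gcongr ?_ * _ * _
        exact sq_div_curvature_le hn

end DmatRows

theorem Dmat_sub_one_opInf_le (n r : ℕ) (hn : 2 ≤ n) (τ : Fin r → ℝ) (α : ℝ) (hα : 0 < α)
    (hsep : α ≤ ((n : ℝ) + 1) * sep τ) :
    opInf (Dmat n r τ - 1) ≤
      (max ((4 / π ^ 2) * α⁻¹ * α +
              (3 * Real.sqrt 3 / (4 * π)) * (((4 / π) * α⁻¹ + (8 / π ^ 2) * α⁻¹ ^ 2) * α))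
           ((3 * Real.sqrt 3 / (4 * π)) * (((4 / π) * α⁻¹ + (8 / π ^ 2) * α⁻¹ ^ 2) * α) +
              (27 / (16 * π ^ 2)) *
                (((80 / 9) * α⁻¹ + (16 / π) * α⁻¹ ^ 2 + (64 / (3 * π ^ 2)) * α⁻¹ ^ 3) * α))) *
        (((n : ℝ) + 1) * sep τ)⁻¹ ^ 2 := by
  have hs : 0 < ((n : ℝ) + 1) * sep τ := hα.trans_le hsep
  have hτ : 0 < sep τ := pos_of_mul_pos_right hs (by positivity)
  have hinv : (((n : ℝ) + 1) * sep τ)⁻¹ ≤ α⁻¹ := inv_anti₀ hα hsep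
  have hinv₀ : 0 ≤ (((n : ℝ) + 1) * sep τ)⁻¹ := inv_nonneg.2 hs.le
  have hC₀ : 4 / π ^ 2 * α⁻¹ * α = 4 / π ^ 2 := by field_simp
  have hC₁ : 3 * √3 / (4 * π) * (4 / π + 8 / π ^ 2 * (((n : ℝ) + 1) * sep τ)⁻¹) ≤
      3 * √3 / (4 * π) * ((4 / π * α⁻¹ + 8 / π ^ 2 * α⁻¹ ^ 2) * α) := by
    rw [show (4 / π * α⁻¹ + 8 / π ^ 2 * α⁻¹ ^ 2) * α = 4 / π + 8 / π ^ 2 * α⁻¹ by field_simp]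
    gcongr
  have hC₂ : 27 / (16 * π ^ 2) * (80 / 9 + 16 / π * (((n : ℝ) + 1) * sep τ)⁻¹ +
        64 / (3 * π ^ 2) * (((n : ℝ) + 1) * sep τ)⁻¹ ^ 2) ≤
      27 / (16 * π ^ 2) *
        ((80 / 9 * α⁻¹ + 16 / π * α⁻¹ ^ 2 + 64 / (3 * π ^ 2) * α⁻¹ ^ 3) * α) := by
    rw [show (80 / 9 * α⁻¹ + 16 / π * α⁻¹ ^ 2 + 64 / (3 * π ^ 2) * α⁻¹ ^ 3) * α =
      80 / 9 + 16 / π * α⁻¹ + 64 / (3 * π ^ 2) * α⁻¹ ^ 2 by field_simp]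
    gcongr
  refine Real.iSup_le (fun i => ?_) (mul_nonneg (le_max_of_le_left (by positivity)) (sq_nonneg _))
  rcases i with i | i
  · refine le_trans ?_ (mul_le_mul_of_nonneg_right (le_max_left _ _) (sq_nonneg _))
    have h1 := sum_abs_fejer_sub_one_le (n := n) i hτ
    have h2 := (sum_abs_deriv_fejer_div_le i hn hτ).trans
      (mul_le_mul_of_nonneg_right hC₁ (sq_nonneg _))
    rw [hC₀, add_mul, Fintype.sum_sum_type]
    refine add_le_add (le_of_eq_of_le ?_ h1) (le_of_eq_of_le ?_ h2)
    · simp [Dmat, Matrix.one_apply]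
    · simp [Dmat]
  · refine le_trans ?_ (mul_le_mul_of_nonneg_right (le_max_right _ _) (sq_nonneg _))
    have h1 := (sum_abs_deriv_fejer_div_le i hn hτ).trans
      (mul_le_mul_of_nonneg_right hC₁ (sq_nonneg _))
    have h2 := (sum_abs_iteratedDeriv_two_fejer_div_sub_one_le i hn hτ).trans
      (mul_le_mul_of_nonneg_right hC₂ (sq_nonneg _))
    rw [add_mul, Fintype.sum_sum_type]
    refine add_le_add (le_of_eq_of_le ?_ h1) (le_of_eq_of_le ?_ h2)
    · refine Finset.sum_congr rfl fun j _ => ?_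
      simp [Dmat, ← neg_sub (τ i) (τ j), deriv_fejer_neg, abs_div, -neg_sub]
    · simp [Dmat, Matrix.one_apply]
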